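/- arXiv:math/0407464 — 4 statements merged into one kernel-verified Lean document; each statement's English description precedes it below -/
import Mathlib

section
/- Let k be a field of characteristic p > 0, let R = k[x_1, ..., x_d], and let n ≥ 1. If f, g, h ∈ R satisfy f = g · h, then J_n(f) ⊆ J_n(g). -/
open MvPolynomial

noncomputable section

variable {k : Type*} [Field k] {d : ℕ}

/-- The divided-power (Hasse) differential operator `D_β` on `k[x_1,…,x_d]`,
determined on monomials by `D_β(x^γ) = (∏ i, choose (γ i) (β i)) x^(γ-β)`
(which is `0` unless `β ≤ γ`, since then some binomial coefficient vanishes). -/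
def Dop (β : Fin d →₀ ℕ) (f : MvPolynomial (Fin d) k) : MvPolynomial (Fin d) k :=
  ∑ γ ∈ f.support, (∏ i, (γ i).choose (β i)) • monomial (γ - β) (coeff γ f)

/-- The component `f_α(x^q)` in the decomposition `f = Σ_{0 ≤ α < q} f_α(x^q) x^α`
of `f` with respect to `x^q` (for `q = p^n`). -/
def Jcomp (q : ℕ) (f : MvPolynomial (Fin d) k) (α : Fin d →₀ ℕ) : MvPolynomial (Fin d) k :=
  ∑ γ ∈ f.support.filter (fun γ => ∀ i, γ i % q = α i), monomial (γ - α) (coeff γ f)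

/-- The ideal `J_n(f)` generated by the components `f_α(x^q)`, `0 ≤ α < q`, where `q = p^n`. -/
def Jideal (q : ℕ) (f : MvPolynomial (Fin d) k) : Ideal (MvPolynomial (Fin d) k) :=
  Ideal.span { g | ∃ α : Fin d →₀ ℕ, (∀ i, α i < q) ∧ g = Jcomp q f α }

/-- The ideal `I_n(f)` generated by the (unique, when they exist) `q`-th roots of the
components `f_α(x^q)`, `0 ≤ α < q`, where `q = p^n`. -/
def Iideal (q : ℕ) (f : MvPolynomial (Fin d) k) : Ideal (MvPolynomial (Fin d) k) :=
  Ideal.span { h | ∃ α : Fin d →₀ ℕ, (∀ i, α i < q) ∧ h ^ q = Jcomp q f α }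

/-- The Frobenius power `I^{[q]}` of an ideal `I`: the ideal generated by `q`-th powers
of elements of `I`. -/
def frobPow (I : Ideal (MvPolynomial (Fin d) k)) (q : ℕ) : Ideal (MvPolynomial (Fin d) k) :=
  Ideal.span ((fun x => x ^ q) '' (I : Set (MvPolynomial (Fin d) k)))

lemma Jcomp_eq_sum {s : Finset (Fin d →₀ ℕ)} (q : ℕ) (f : MvPolynomial (Fin d) k)
    (α : Fin d →₀ ℕ) (hs : f.support ⊆ s) :
    Jcomp q f α = ∑ γ ∈ s, if ∀ i, γ i % q = α i then monomial (γ - α) (coeff γ f) else 0 := by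
  rw [Jcomp, Finset.sum_filter]
  refine Finset.sum_subset hs fun γ _ hγ => ?_
  simp [notMem_support_iff.mp hγ]

lemma Jcomp_add (q : ℕ) (f g : MvPolynomial (Fin d) k) (α : Fin d →₀ ℕ) :
    Jcomp q (f + g) α = Jcomp q f α + Jcomp q g α := by
  classical
  rw [Jcomp_eq_sum q (f + g) α support_add, Jcomp_eq_sum q f α Finset.subset_union_left,
    Jcomp_eq_sum q g α Finset.subset_union_right, ← Finset.sum_add_distrib]
  refine Finset.sum_congr rfl fun γ _ => ?_
  split_ifs <;> simp

lemma Jcomp_monomial (q : ℕ) (γ α : Fin d →₀ ℕ) (a : k) :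
    Jcomp q (monomial γ a) α =
      if ∀ i, γ i % q = α i then monomial (γ - α) a else 0 := by
  rw [Jcomp_eq_sum q _ α support_monomial_subset]
  simp

/-- Multiplication by a monomial permutes the components up to monomial factors. -/
lemma exists_Jcomp_mul_monomial_eq {q : ℕ} (b α : Fin d →₀ ℕ) (hα : ∀ i, α i < q) (c : k) :
    ∃ e α' : Fin d →₀ ℕ, (∀ i, α' i < q) ∧ ∀ g : MvPolynomial (Fin d) k,
      Jcomp q (g * monomial b c) α = monomial e c * Jcomp q g α' := by
  have hres : ∀ i, ∃ m < q, (m + b i) % q = α i := fun i => by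
    have hq : 0 < q := (Nat.zero_le _).trans_lt (hα i)
    refine ⟨(α i + (q - b i % q)) % q, Nat.mod_lt _ hq, ?_⟩
    have hb := Nat.mod_lt (b i) hq
    rw [Nat.mod_add_mod, ← Nat.add_mod_mod,
      show α i + (q - b i % q) + b i % q = α i + q by omega, Nat.add_mod_right,
      Nat.mod_eq_of_lt (hα i)]
  choose m hmq hm using hres
  let α' : Fin d →₀ ℕ := Finsupp.equivFunOnFinite.symm m
  have hle : ∀ i, α i ≤ m i + b i := fun i => hm i ▸ Nat.mod_le _ _
  refine ⟨α' + b - α, α', hmq, fun g => ?_⟩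
  induction g using MvPolynomial.induction_on' with
  | add f g hf hg => rw [add_mul, Jcomp_add, hf, hg, Jcomp_add, mul_add]
  | monomial γ a =>
    have hiff : (∀ i, (γ + b) i % q = α i) ↔ ∀ i, γ i % q = α' i := by
      refine forall_congr' fun i => ?_
      change (γ i + b i) % q = α i ↔ γ i % q = m i
      rw [← hm i, ← Nat.mod_eq_of_lt (hmq i)]
      simp only [Nat.mod_add_mod]
      exact ⟨Nat.ModEq.add_right_cancel' _, Nat.ModEq.add_right _⟩
    rw [monomial_mul, Jcomp_monomial, Jcomp_monomial]
    by_cases h : ∀ i, γ i % q = α' i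
    · rw [if_pos (hiff.mpr h), if_pos h, monomial_mul, mul_comm a c]
      congr 2
      ext i
      have hγ : m i ≤ γ i := (h i).symm.le.trans (Nat.mod_le _ _)
      have hαi := hle i
      change γ i + b i - α i = m i + b i - α i + (γ i - m i)
      omega
    · rw [if_neg (hiff.not.mpr h), if_neg h, mul_zero]

lemma Jcomp_mul_mem_Jideal {q : ℕ} (g h : MvPolynomial (Fin d) k) {α : Fin d →₀ ℕ}
    (hα : ∀ i, α i < q) : Jcomp q (g * h) α ∈ Jideal q g := by
  induction h using MvPolynomial.induction_on' with
  | add h₁ h₂ ih₁ ih₂ =>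
    rw [mul_add, Jcomp_add]
    exact add_mem ih₁ ih₂
  | monomial b c =>
    obtain ⟨e, α', hα', he⟩ := exists_Jcomp_mul_monomial_eq b α hα c
    rw [he]
    exact Ideal.mul_mem_left _ _ (Ideal.subset_span ⟨α', hα', rfl⟩)

/-- if `f = g·h` then `J_n(f) ⊆ J_n(g)`. -/
theorem stmt6 (p : ℕ) [Fact p.Prime] (k : Type*) [Field k] [CharP k p]
    (d n : ℕ) (hn : 1 ≤ n) (f g h : MvPolynomial (Fin d) k) (hfgh : f = g * h) :
    Jideal (p ^ n) f ≤ Jideal (p ^ n) g := by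
  subst hfgh
  refine Ideal.span_le.mpr ?_
  rintro _ ⟨α, hα, rfl⟩
  exact Jcomp_mul_mem_Jideal g h hα
end
end

section
/- Let k be a perfect field of characteristic p > 0, let R = k[x_1, ..., x_d], let f ∈ R, and let n ≥ 1 be an integer. Then I_n(f^(p^n − 1)) ⊆ I_{n−1}(f^(p^{n−1} − 1)). -/
open MvPolynomial

noncomputable section

variable {k : Type*} [Field k] {d : ℕ}

/-- The `p^m`-th root of the component `f_α(x^{p^m})` of `f`. -/
def rootComp (p : ℕ) [Fact p.Prime] [CharP k p] [PerfectRing k p] (m : ℕ) (α : Fin d →₀ ℕ)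
    (f : MvPolynomial (Fin d) k) : MvPolynomial (Fin d) k :=
  ∑ γ ∈ f.support.filter (fun γ => ∀ i, γ i % p ^ m = α i),
    monomial (γ.mapRange (· / p ^ m) (Nat.zero_div _))
      ((iterateFrobeniusEquiv k p m).symm (coeff γ f))

section rootComp

variable (p : ℕ) [Fact p.Prime] [CharP k p] [PerfectRing k p] (m : ℕ)

theorem pow_iterateFrobeniusEquiv_symm (c : k) :
    ((iterateFrobeniusEquiv k p m).symm c) ^ p ^ m = c := by
  rw [← iterateFrobenius_def, ← coe_iterateFrobeniusEquiv]
  exact (iterateFrobeniusEquiv k p m).apply_symm_apply c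

theorem rootComp_pow (α : Fin d →₀ ℕ) (f : MvPolynomial (Fin d) k) :
    rootComp p m α f ^ p ^ m = Jcomp (p ^ m) f α := by
  rw [rootComp, Jcomp, sum_pow_char_pow]
  refine Finset.sum_congr rfl fun γ hγ => ?_
  rw [monomial_pow, pow_iterateFrobeniusEquiv_symm]
  congr 2
  ext i
  have h := (Finset.mem_filter.mp hγ).2 i
  have h' := Nat.mod_add_div (γ i) (p ^ m)
  simp only [Finsupp.smul_apply, Finsupp.mapRange_apply, Finsupp.tsub_apply, smul_eq_mul]
  lia

theorem coeff_rootComp_pow {α : Fin d →₀ ℕ} (hα : ∀ i, α i < p ^ m) (f : MvPolynomial (Fin d) k)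
    (μ : Fin d →₀ ℕ) :
    coeff μ (rootComp p m α f) ^ p ^ m = coeff (α + p ^ m • μ) f := by
  have hq : 0 < p ^ m := pow_pos (Fact.out : p.Prime).pos m
  suffices coeff μ (rootComp p m α f) =
      (iterateFrobeniusEquiv k p m).symm (coeff (α + p ^ m • μ) f) by
    rw [this, pow_iterateFrobeniusEquiv_symm]
  have hdiv : (α + p ^ m • μ).mapRange (· / p ^ m) (Nat.zero_div _) = μ := by
    ext i
    simp [Nat.add_mul_div_left _ _ hq, Nat.div_eq_of_lt (hα i)]
  rw [rootComp, coeff_sum, Finset.sum_eq_single (α + p ^ m • μ)]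
  · rw [coeff_monomial, if_pos hdiv]
  · intro γ hγ hne
    rw [coeff_monomial, if_neg]
    rintro rfl
    refine hne ?_
    ext i
    have h := (Finset.mem_filter.mp hγ).2 i
    simpa [h] using (Nat.mod_add_div (γ i) (p ^ m)).symm
  · intro h
    have hmod : ∀ i, (α + p ^ m • μ) i % p ^ m = α i := fun i => by
      simp [Nat.mod_eq_of_lt (hα i)]
    have : coeff (α + p ^ m • μ) f = 0 := by
      by_contra h0
      exact h (Finset.mem_filter.mpr ⟨mem_support_iff.mpr h0, hmod⟩)
    simp [this]

theorem pow_char_pow_injective {A : Type*} [CommRing A] [IsDomain A] [CharP A p] :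
    Function.Injective fun a : A => a ^ p ^ m :=
  iterateFrobenius_inj A p m

theorem eq_rootComp_of_coeff {α : Fin d →₀ ℕ} (hα : ∀ i, α i < p ^ m)
    {f h : MvPolynomial (Fin d) k}
    (H : ∀ μ, coeff μ h ^ p ^ m = coeff (α + p ^ m • μ) f) : h = rootComp p m α f := by
  ext μ
  apply pow_char_pow_injective p m
  simp only [H, coeff_rootComp_pow p m hα]

theorem rootComp_add {α : Fin d →₀ ℕ} (hα : ∀ i, α i < p ^ m) (f g : MvPolynomial (Fin d) k) :
    rootComp p m α (f + g) = rootComp p m α f + rootComp p m α g := by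
  refine (eq_rootComp_of_coeff p m hα fun μ => ?_).symm
  simp only [coeff_add, add_pow_char_pow, coeff_rootComp_pow p m hα]

theorem rootComp_zero {α : Fin d →₀ ℕ} : rootComp p m α (0 : MvPolynomial (Fin d) k) = 0 := by
  simp [rootComp]

theorem rootComp_pow_mul {α : Fin d →₀ ℕ} (hα : ∀ i, α i < p ^ m)
    (r f : MvPolynomial (Fin d) k) :
    rootComp p m α (r ^ p ^ m * f) = r * rootComp p m α f := by
  have hq : 0 < p ^ m := pow_pos (Fact.out : p.Prime).pos m
  induction r using MvPolynomial.induction_on' with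
  | monomial ν c =>
    refine (eq_rootComp_of_coeff p m hα fun μ => ?_).symm
    rw [monomial_pow, coeff_monomial_mul', coeff_monomial_mul']
    have hle : p ^ m • ν ≤ α + p ^ m • μ ↔ ν ≤ μ := by
      refine forall_congr' fun i => ?_
      simp only [Finsupp.smul_apply, Finsupp.add_apply, smul_eq_mul]
      refine ⟨fun h => ?_, fun h => (Nat.mul_le_mul_left _ h).trans (Nat.le_add_left _ _)⟩
      have h1 : p ^ m * ν i < p ^ m * (μ i + 1) := by
        have := hα i
        rw [mul_add, mul_one]
        lia
      exact Nat.lt_succ_iff.mp (Nat.lt_of_mul_lt_mul_left h1)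
    by_cases h : ν ≤ μ
    · have hsub : α + p ^ m • μ - p ^ m • ν = α + p ^ m • (μ - ν) := by
        obtain ⟨ρ, rfl⟩ := exists_add_of_le h
        rw [add_tsub_cancel_left, smul_add, add_left_comm, add_tsub_cancel_left]
      rw [if_pos h, if_pos (hle.mpr h), mul_pow, coeff_rootComp_pow p m hα, hsub]
    · rw [if_neg h, if_neg (mt hle.mp h), zero_pow hq.ne']
  | add r s hr hs =>
    rw [add_pow_char_pow, add_mul, rootComp_add p m hα, hr, hs, add_mul]

theorem Iideal_eq_span_rootComp (f : MvPolynomial (Fin d) k) :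
    Iideal (p ^ m) f =
      Ideal.span { h | ∃ α : Fin d →₀ ℕ, (∀ i, α i < p ^ m) ∧ h = rootComp p m α f } := by
  unfold Iideal
  congr 1
  ext h
  refine exists_congr fun α => and_congr_right fun _ => ?_
  rw [← rootComp_pow]
  exact (pow_char_pow_injective p m).eq_iff

theorem mem_frobPow_Iideal (f : MvPolynomial (Fin d) k) :
    f ∈ frobPow (Iideal (p ^ m) f) (p ^ m) := by
  have hq : 0 < p ^ m := pow_pos (Fact.out : p.Prime).pos m
  have hf : f = ∑ γ ∈ f.support, monomial γ (coeff γ f) := f.as_sum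
  let res : (Fin d →₀ ℕ) → (Fin d →₀ ℕ) := fun γ => γ.mapRange (· % p ^ m) (Nat.zero_mod _)
  rw [← Finset.sum_fiberwise_of_maps_to (g := res)
    (fun γ hγ => Finset.mem_image_of_mem res hγ)] at hf
  have hmem : ∀ α ∈ f.support.image res,
      ∑ γ ∈ f.support with res γ = α, monomial γ (coeff γ f) ∈
        frobPow (Iideal (p ^ m) f) (p ^ m) := by
    intro α hα
    have hlt : ∀ i, α i < p ^ m := by
      obtain ⟨γ, -, rfl⟩ := Finset.mem_image.mp hα
      exact fun i => Nat.mod_lt _ hq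
    have hsum : ∑ γ ∈ f.support with res γ = α, monomial γ (coeff γ f) =
        monomial α 1 * rootComp p m α f ^ p ^ m := by
      rw [rootComp_pow, Jcomp, Finset.mul_sum]
      refine Finset.sum_congr (Finset.filter_congr fun γ _ => DFunLike.ext_iff) fun γ hγ => ?_
      rw [monomial_mul, one_mul, add_tsub_cancel_of_le]
      intro i
      rw [← (Finset.mem_filter.mp hγ).2 i]
      exact Nat.mod_le _ _
    rw [hsum]
    refine Ideal.mul_mem_left _ _ (Ideal.subset_span ⟨_, ?_, rfl⟩)
    exact Ideal.subset_span ⟨α, hlt, rootComp_pow p m α f⟩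
  rw [hf]
  simpa only [← hf] using Ideal.sum_mem _ hmem

theorem rootComp_mem_of_mem_frobPow {α : Fin d →₀ ℕ} (hα : ∀ i, α i < p ^ m)
    {I : Ideal (MvPolynomial (Fin d) k)} {f : MvPolynomial (Fin d) k}
    (hf : f ∈ frobPow I (p ^ m)) : rootComp p m α f ∈ I := by
  refine Submodule.closure_induction (p := fun f _ => rootComp p m α f ∈ I) ?_ ?_ ?_ hf
  · rw [rootComp_zero]
    exact I.zero_mem
  · intro f g _ _ hf hg
    rw [rootComp_add p m hα]
    exact I.add_mem hf hg
  · rintro r _ ⟨s, hs, rfl⟩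
    simp only [smul_eq_mul]
    rw [mul_comm, rootComp_pow_mul p m hα]
    exact I.mul_mem_right _ hs

theorem rootComp_rootComp {α β : Fin d →₀ ℕ} (hα : ∀ i, α i < p ^ m) (hβ : ∀ i, β i < p)
    (f : MvPolynomial (Fin d) k) :
    rootComp p m α (rootComp p 1 β f) = rootComp p (m + 1) (β + p • α) f := by
  refine eq_rootComp_of_coeff p (m + 1) (fun i => ?_) fun μ => ?_
  · have h1 : p * (α i + 1) ≤ p * p ^ m := Nat.mul_le_mul_left _ (hα i)
    have h2 := hβ i
    simp only [Finsupp.add_apply, Finsupp.smul_apply, smul_eq_mul, pow_succ']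
    lia
  · have h := coeff_rootComp_pow p 1 (by simpa using hβ) f (α + p ^ m • μ)
    rw [pow_succ, pow_mul, coeff_rootComp_pow p m hα]
    rw [pow_one] at h
    rw [h, smul_add, smul_smul, ← add_assoc, mul_comm]

end rootComp

/-- over a perfect field, `I_n(f^(p^n - 1)) ⊆ I_{n-1}(f^(p^{n-1} - 1))`. -/
theorem stmt9 (p : ℕ) [Fact p.Prime] (k : Type*) [Field k] [CharP k p] [PerfectRing k p]
    (d n : ℕ) (hn : 1 ≤ n) (f : MvPolynomial (Fin d) k) :
    Iideal (p ^ n) (f ^ (p ^ n - 1)) ≤ Iideal (p ^ (n - 1)) (f ^ (p ^ (n - 1) - 1)) := by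
  obtain ⟨m, rfl⟩ := Nat.exists_eq_add_of_le' hn
  rw [Nat.add_sub_cancel, Iideal_eq_span_rootComp, Ideal.span_le]
  rintro _ ⟨α, hα, rfl⟩
  have hp : 0 < p := (Fact.out : p.Prime).pos
  have hexp : p ^ (m + 1) - 1 = (p ^ m - 1) * p ^ 1 + (p - 1) := by
    have h1 : 1 ≤ p ^ m := Nat.one_le_pow _ _ hp
    obtain ⟨a, ha⟩ := Nat.exists_eq_add_of_le' h1
    rw [pow_succ, ha, Nat.add_sub_cancel, pow_one, add_mul, one_mul]
    lia
  let β : Fin d →₀ ℕ := α.mapRange (· % p) (Nat.zero_mod _)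
  let δ : Fin d →₀ ℕ := α.mapRange (· / p) (Nat.zero_div _)
  have hβ : ∀ i, β i < p := fun i => Nat.mod_lt _ hp
  have hδ : ∀ i, δ i < p ^ m := fun i => Nat.div_lt_of_lt_mul (by
    rw [← pow_succ']
    exact hα i)
  have hαβδ : α = β + p • δ := by
    ext i
    exact (Nat.mod_add_div (α i) p).symm
  rw [SetLike.mem_coe, hαβδ, ← rootComp_rootComp p m hδ hβ, hexp, pow_add, pow_mul,
    rootComp_pow_mul p 1 (by simpa using hβ)]
  refine rootComp_mem_of_mem_frobPow p m hδ ?_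
  exact Ideal.mul_mem_right _ _ (mem_frobPow_Iideal p m _)
end
end

section
/- Let k be a perfect field of characteristic p > 0, let R = k[x_1, ..., x_d], let f ∈ R be a nonzero polynomial, and let s ≥ 1 be an integer such that I_{s−1}(f^(p^{s−1} − 1)) = I_s(f^(p^s − 1)). Then J_s(f^(p^s − p)) = J_s(f^(p^s − 1)); in particular f^(p^s − p) ∈ J_s(f^(p^s − 1)). -/
open MvPolynomial

noncomputable section

variable {k : Type*} [Field k] {d : ℕ}

theorem coeff_smul_pow_char {p : ℕ} [Fact p.Prime] [CharP k p] (g : MvPolynomial (Fin d) k)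
    (γ : Fin d →₀ ℕ) : coeff (p • γ) (g ^ p) = coeff γ g ^ p := by
  rw [← map_frobenius_expand (p := p) (f := g), coeff_map,
    coeff_expand_smul _ (Fact.out : p.Prime).ne_zero, frobenius_def]

theorem coeff_pow_char_of_not_dvd {p : ℕ} [Fact p.Prime] [CharP k p] (g : MvPolynomial (Fin d) k)
    {γ : Fin d →₀ ℕ} {i : Fin d} (hi : ¬ p ∣ γ i) : coeff γ (g ^ p) = 0 := by
  rw [← map_frobenius_expand (p := p) (f := g), coeff_map, coeff_expand_of_not_dvd _ hi, map_zero]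

theorem exists_eq_smul_of_dvd {q : ℕ} {γ : Fin d →₀ ℕ} (h : ∀ i, q ∣ γ i) :
    ∃ δ : Fin d →₀ ℕ, γ = q • δ := by
  choose c hc using h
  exact ⟨Finsupp.equivFunOnFinite.symm c, Finsupp.ext fun i => by simpa using hc i⟩

theorem le_of_mod_eq {q : ℕ} {α γ : Fin d →₀ ℕ} (h : ∀ i, γ i % q = α i) : α ≤ γ :=
  fun i => (h i).symm.le.trans (Nat.mod_le _ _)

theorem coeff_Jcomp {q : ℕ} (g : MvPolynomial (Fin d) k) {α : Fin d →₀ ℕ} (hα : ∀ i, α i < q)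
    (δ : Fin d →₀ ℕ) :
    coeff δ (Jcomp q g α) = if ∀ i, q ∣ δ i then coeff (δ + α) g else 0 := by
  simp only [Jcomp, coeff_sum, coeff_monomial]
  have key : ∀ γ ∈ g.support.filter (fun γ => ∀ i, γ i % q = α i),
      (if γ - α = δ then coeff γ g else 0) = if γ = δ + α then coeff γ g else 0 := by
    intro γ hγ
    have hle := le_of_mod_eq (Finset.mem_filter.1 hγ).2
    simp only [tsub_eq_iff_eq_add_of_le hle]
  rw [Finset.sum_congr rfl key, Finset.sum_ite_eq']
  have hmod : (∀ i, (δ + α) i % q = α i) ↔ ∀ i, q ∣ δ i := by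
    refine forall_congr' fun i => ?_
    rw [Finsupp.add_apply]
    constructor
    · intro h
      have h' : α i ≡ δ i + α i [MOD q] := by
        rw [Nat.ModEq, h, Nat.mod_eq_of_lt (hα i)]
      simpa using (Nat.modEq_iff_dvd' (Nat.le_add_left _ _)).1 h'
    · rintro ⟨c, hc⟩
      rw [hc, Nat.mul_add_mod, Nat.mod_eq_of_lt (hα i)]
  split_ifs <;> simp_all

theorem Jcomp_pow_char {p : ℕ} [Fact p.Prime] [CharP k p] {q : ℕ} (g : MvPolynomial (Fin d) k)
    {α : Fin d →₀ ℕ} (hα : ∀ i, α i < q) :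
    Jcomp (p * q) (g ^ p) (p • α) = Jcomp q g α ^ p := by
  have hp : 0 < p := (Fact.out : p.Prime).pos
  have hpα : ∀ i, (p • α) i < p * q := fun i => by
    simpa using Nat.mul_lt_mul_of_pos_left (hα i) hp
  ext δ
  rw [coeff_Jcomp _ hpα]
  by_cases hδ : ∀ i, p ∣ δ i
  · obtain ⟨ε, rfl⟩ := exists_eq_smul_of_dvd hδ
    rw [coeff_smul_pow_char, coeff_Jcomp _ hα, ← smul_add, coeff_smul_pow_char]
    simp only [Finsupp.smul_apply, smul_eq_mul, Nat.mul_dvd_mul_iff_left hp, ite_pow,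
      zero_pow hp.ne']
  · rw [if_neg fun h => hδ fun i => (dvd_mul_right p q).trans (h i)]
    obtain ⟨i, hi⟩ := not_forall.1 hδ
    rw [coeff_pow_char_of_not_dvd _ hi]

theorem Jcomp_pow_char_of_not_dvd {p : ℕ} [Fact p.Prime] [CharP k p] {q : ℕ}
    (g : MvPolynomial (Fin d) k) {α : Fin d →₀ ℕ} (hα : ∀ i, α i < p * q)
    {i : Fin d} (hi : ¬ p ∣ α i) : Jcomp (p * q) (g ^ p) α = 0 := by
  ext δ
  rw [coeff_Jcomp _ hα, coeff_zero]
  split_ifs with h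
  · refine coeff_pow_char_of_not_dvd (i := i) _ ?_
    rwa [Finsupp.add_apply, Nat.dvd_add_right ((dvd_mul_right p q).trans (h i))]
  · rfl

theorem Jideal_pow_char {p : ℕ} [Fact p.Prime] [CharP k p] (q : ℕ)
    (g : MvPolynomial (Fin d) k) :
    Jideal (p * q) (g ^ p) = (Jideal q g).map (frobenius (MvPolynomial (Fin d) k) p) := by
  have hp : 0 < p := (Fact.out : p.Prime).pos
  rw [Jideal, Jideal, Ideal.map_span]
  apply le_antisymm <;> rw [Ideal.span_le]
  · rintro _ ⟨α, hα, rfl⟩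
    by_cases h : ∀ i, p ∣ α i
    · obtain ⟨β, rfl⟩ := exists_eq_smul_of_dvd h
      have hβ : ∀ i, β i < q := fun i => Nat.lt_of_mul_lt_mul_left (a := p) (by simpa using hα i)
      exact Ideal.subset_span ⟨_, ⟨β, hβ, rfl⟩, (Jcomp_pow_char g hβ).symm⟩
    · obtain ⟨i, hi⟩ := not_forall.1 h
      rw [Jcomp_pow_char_of_not_dvd g hα hi]
      exact zero_mem _
  · rintro _ ⟨_, ⟨α, hα, rfl⟩, rfl⟩
    refine Ideal.subset_span ⟨p • α, fun i => ?_, (Jcomp_pow_char g hα).symm⟩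
    simpa using Nat.mul_lt_mul_of_pos_left (hα i) hp

theorem exists_pow_eq_Jcomp (p : ℕ) [Fact p.Prime] [CharP k p] [PerfectRing k p] (n : ℕ)
    (g : MvPolynomial (Fin d) k) (α : Fin d →₀ ℕ) :
    ∃ h : MvPolynomial (Fin d) k, h ^ p ^ n = Jcomp (p ^ n) g α := by
  suffices Jcomp (p ^ n) g α ∈ (iterateFrobenius (MvPolynomial (Fin d) k) p n).range by
    obtain ⟨h, hh⟩ := this
    exact ⟨h, by rw [← hh, iterateFrobenius_def]⟩
  refine sum_mem fun γ hγ => ?_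
  have hmod := (Finset.mem_filter.1 hγ).2
  obtain ⟨δ, hδ⟩ : ∃ δ : Fin d →₀ ℕ, γ - α = p ^ n • δ := exists_eq_smul_of_dvd fun i => by
    rw [Finsupp.tsub_apply, ← hmod i]
    exact Nat.dvd_sub_mod _
  obtain ⟨c, hc⟩ := (bijective_iterateFrobenius k p n).2 (coeff γ g)
  refine ⟨monomial δ c, ?_⟩
  rw [iterateFrobenius_def, monomial_pow, hδ, ← hc, iterateFrobenius_def]

theorem map_iterateFrobenius_Iideal (p : ℕ) [Fact p.Prime] [CharP k p] [PerfectRing k p] (n : ℕ)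
    (g : MvPolynomial (Fin d) k) :
    (Iideal (p ^ n) g).map (iterateFrobenius (MvPolynomial (Fin d) k) p n) =
      Jideal (p ^ n) g := by
  rw [Iideal, Jideal, Ideal.map_span]
  congr 1
  ext y
  constructor
  · rintro ⟨h, ⟨α, hα, hh⟩, rfl⟩
    exact ⟨α, hα, hh⟩
  · rintro ⟨α, hα, rfl⟩
    obtain ⟨h, hh⟩ := exists_pow_eq_Jcomp p n g α
    exact ⟨h, ⟨α, hα, hh⟩, hh⟩

theorem mem_Jideal {q : ℕ} (hq : 0 < q) (g : MvPolynomial (Fin d) k) : g ∈ Jideal q g := by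
  let r : (Fin d →₀ ℕ) → (Fin d →₀ ℕ) := Finsupp.mapRange (· % q) (Nat.zero_mod q)
  have hg : ∑ α ∈ g.support.image r, Jcomp q g α * monomial α 1 = g := by
    conv_rhs => rw [g.as_sum,
      ← Finset.sum_fiberwise_of_maps_to fun γ hγ => Finset.mem_image_of_mem r hγ]
    refine Finset.sum_congr rfl fun α _ => ?_
    have hr : ∀ γ, r γ = α ↔ ∀ i, γ i % q = α i := fun γ => by simp [r, Finsupp.ext_iff]
    simp only [hr, Jcomp, Finset.sum_mul]
    refine Finset.sum_congr rfl fun γ hγ => ?_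
    rw [monomial_mul, tsub_add_cancel_of_le (le_of_mod_eq (Finset.mem_filter.1 hγ).2), mul_one]
  suffices ∑ α ∈ g.support.image r, Jcomp q g α * monomial α 1 ∈ Jideal q g by rwa [hg] at this
  refine sum_mem fun α hα => Ideal.mul_mem_right _ _ (Ideal.subset_span ⟨α, fun i => ?_, rfl⟩)
  obtain ⟨γ, -, rfl⟩ := Finset.mem_image.1 hα
  simpa [r] using Nat.mod_lt _ hq

/-- if the chain of ideals `I` stabilizes at step `s`, i.e.
`I_{s-1}(f^(p^{s-1} - 1)) = I_s(f^(p^s - 1))`, then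
`J_s(f^(p^s - p)) = J_s(f^(p^s - 1))`; in particular `f^(p^s - p) ∈ J_s(f^(p^s - 1))`. -/
theorem stmt13 (p : ℕ) [Fact p.Prime] (k : Type*) [Field k] [CharP k p] [PerfectRing k p]
    (d s : ℕ) (hs : 1 ≤ s) (f : MvPolynomial (Fin d) k) (hf : f ≠ 0)
    (hstab : Iideal (p ^ (s - 1)) (f ^ (p ^ (s - 1) - 1)) = Iideal (p ^ s) (f ^ (p ^ s - 1))) :
    Jideal (p ^ s) (f ^ (p ^ s - p)) = Jideal (p ^ s) (f ^ (p ^ s - 1)) ∧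
    f ^ (p ^ s - p) ∈ Jideal (p ^ s) (f ^ (p ^ s - 1)) := by
  obtain ⟨n, rfl⟩ : ∃ n, s = n + 1 := ⟨s - 1, by omega⟩
  have hp : 0 < p := (Fact.out : p.Prime).pos
  have hexp : f ^ (p ^ (n + 1) - p) = (f ^ (p ^ n - 1)) ^ p := by
    rw [← pow_mul, Nat.sub_mul, one_mul, ← pow_succ]
  have hJ : Jideal (p ^ (n + 1)) (f ^ (p ^ (n + 1) - p)) =
      Jideal (p ^ (n + 1)) (f ^ (p ^ (n + 1) - 1)) := by
    rw [← map_iterateFrobenius_Iideal p (n + 1) (f ^ (p ^ (n + 1) - 1)), ← hstab,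
      Nat.add_sub_cancel, hexp, pow_succ' p n, Jideal_pow_char,
      ← map_iterateFrobenius_Iideal p n, Ideal.map_map]
    congr 1
    refine RingHom.ext fun x => ?_
    simp only [RingHom.comp_apply, frobenius_def, iterateFrobenius_def, ← pow_mul, pow_succ]
  exact ⟨hJ, hJ ▸ mem_Jideal (pow_pos hp _) _⟩
end
end

section
/- Let p be a prime with p ≡ 3 (mod 4) and let k be a field of characteristic p. In R = k[x_1, x_2, x_3, x_4], the coefficient of the monomial x_1^{(p+1)/2} x_2^{(p+1)/2} x_3^{(p−3)/2} x_4^{(p−3)/2} in (x_1² + x_2² + x_3² + x_4²)^{p−1} equals the image in k of the multinomial coefficient (p−1)!/((((p+1)/4)!)²(((p−3)/4)!)²), and this coefficient is nonzero in k. -/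
open MvPolynomial

noncomputable section

variable {k : Type*} [Field k] {d : ℕ}

/-- The coefficient of `∏ i, X i ^ (m * a i)` in `(∑ i, X i ^ m) ^ ∑ i, a i` is the
multinomial coefficient of `a`. -/
theorem coeff_sum_X_pow_pow {σ R : Type*} [Fintype σ] [CommSemiring R] {m : ℕ} (hm : m ≠ 0)
    (a : σ → ℕ) :
    coeff (Finsupp.equivFunOnFinite.symm fun i => m * a i)
      ((∑ i, X i ^ m : MvPolynomial σ R) ^ ∑ i, a i) = (Nat.multinomial Finset.univ a : R) := by
  classical
  have prod_X_pow (b : σ → ℕ) : (∏ i, (X i ^ m) ^ b i : MvPolynomial σ R) =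
      monomial (Finsupp.equivFunOnFinite.symm fun i => m * b i) 1 := by
    rw [monomial_eq, Finsupp.prod_fintype _ _ (fun i => pow_zero _)]
    simp [pow_mul]
  rw [Finset.sum_pow_eq_sum_piAntidiag, coeff_sum, Finset.sum_eq_single a]
  · rw [prod_X_pow, ← C_eq_coe_nat, coeff_C_mul, coeff_monomial, if_pos rfl, mul_one]
  · intro b _ hb
    rw [prod_X_pow, ← C_eq_coe_nat, coeff_C_mul, coeff_monomial, if_neg, mul_zero]
    intro h
    refine hb (funext fun i => Nat.eq_of_mul_eq_mul_left (Nat.pos_of_ne_zero hm) ?_)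
    exact congrFun (Finsupp.equivFunOnFinite.symm.injective h) i
  · intro h
    simp at h

theorem not_dvd_multinomial_of_sum_lt {ι : Type*} {p : ℕ} (hp : p.Prime) (s : Finset ι)
    (a : ι → ℕ) (h : ∑ i ∈ s, a i < p) : ¬ p ∣ Nat.multinomial s a := fun hd =>
  (hp.dvd_factorial.not.2 h.not_ge)
    (Nat.multinomial_spec s a ▸ hd.mul_left (∏ i ∈ s, (a i).factorial))

/-- for `p ≡ 3 (mod 4)`, the coefficient of
`x_1^{(p+1)/2} x_2^{(p+1)/2} x_3^{(p-3)/2} x_4^{(p-3)/2}` in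
`(x_1² + x_2² + x_3² + x_4²)^(p-1)` is the image in `k` of
`(p-1)!/((((p+1)/4)!)²(((p-3)/4)!)²)`, and it is nonzero. -/
theorem stmt17 (p : ℕ) (hp : p.Prime) (hp4 : p % 4 = 3) (k : Type*) [Field k] [CharP k p] :
    coeff (Finsupp.equivFunOnFinite.symm
        ![(p + 1) / 2, (p + 1) / 2, (p - 3) / 2, (p - 3) / 2])
        ((X 0 ^ 2 + X 1 ^ 2 + X 2 ^ 2 + X 3 ^ 2 : MvPolynomial (Fin 4) k) ^ (p - 1))
      = (((p - 1).factorial / (((p + 1) / 4).factorial ^ 2 * ((p - 3) / 4).factorial ^ 2) : ℕ) : k) ∧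
    (((p - 1).factorial / (((p + 1) / 4).factorial ^ 2 * ((p - 3) / 4).factorial ^ 2) : ℕ) : k) ≠ 0 := by
  obtain ⟨n, rfl⟩ : ∃ n, p = 4 * n + 3 := ⟨p / 4, by omega⟩
  rw [show (4 * n + 3 + 1) / 2 = 2 * (n + 1) by omega, show (4 * n + 3 - 3) / 2 = 2 * n by omega,
    show (4 * n + 3 + 1) / 4 = n + 1 by omega, show (4 * n + 3 - 3) / 4 = n by omega,
    show 4 * n + 3 - 1 = 4 * n + 2 by omega]
  let a : Fin 4 → ℕ := ![n + 1, n + 1, n, n]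
  have sum_a : ∑ i, a i = 4 * n + 2 := by
    simp only [a, Fin.sum_univ_four, Matrix.cons_val]
    ring
  have multinomial_a : Nat.multinomial Finset.univ a =
      (4 * n + 2).factorial / ((n + 1).factorial ^ 2 * n.factorial ^ 2) := by
    rw [Nat.multinomial, sum_a]
    congr 1
    simp only [a, Fin.prod_univ_four, Matrix.cons_val]
    ring
  have exponent_eq : ![2 * (n + 1), 2 * (n + 1), 2 * n, 2 * n] = fun i => 2 * a i := by
    ext i
    fin_cases i <;> rfl
  rw [← multinomial_a]
  refine ⟨?_, ?_⟩
  · rw [← coeff_sum_X_pow_pow two_ne_zero a, sum_a, Fin.sum_univ_four, exponent_eq]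
  · rw [Ne, CharP.cast_eq_zero_iff k (4 * n + 3)]
    exact not_dvd_multinomial_of_sum_lt hp _ a (by omega)
end
end
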